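/- arXiv:2301.12001 — 7 statements merged into one kernel-verified Lean document; each statement's English description precedes it below -/
import Mathlib

section
/- Let V be a finite set of points in ℝ^n (modeled as Fin n → ℝ) such that every element of V is an extreme point of the polytope P = convexHull ℝ V, and let v, w ∈ V be distinct. Then the following are equivalent: (1) v and w are adjacent vertices of P, i.e. there exists c : Fin n → ℝ with ⟨c,v⟩ = ⟨c,w⟩ and ⟨c,u⟩ < ⟨c,v⟩ for every u ∈ V \ {v,w}, where ⟨c,x⟩ = ∑ i, c i * x i; (2) the midpoint (v+w)/2 does not belong to convexHull ℝ (V \ {v}) and does not belong to convexHull ℝ (V \ {w}). -/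
lemma aux_dot {n : ℕ} (c x y : Fin n → ℝ) (a b : ℝ) :
    (∑ i, c i * (a • x + b • y) i) = a * (∑ i, c i * x i) + b * ∑ i, c i * y i := by
  rw [Finset.mul_sum, Finset.mul_sum, ← Finset.sum_add_distrib]
  refine Finset.sum_congr rfl fun i _ => ?_
  simp only [Pi.add_apply, Pi.smul_apply, smul_eq_mul]
  ring

lemma aux_face {n : ℕ} (S : Set (Fin n → ℝ)) (c w : Fin n → ℝ)
    (h : ∀ u ∈ S, u ≠ w → (∑ i, c i * u i) < ∑ i, c i * w i)
    (x : Fin n → ℝ) (hx : x ∈ convexHull ℝ S)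
    (hxw : (∑ i, c i * x i) = ∑ i, c i * w i) : x = w := by
  have hsub : convexHull ℝ S ⊆ {x | x = w ∨ (∑ i, c i * x i) < ∑ i, c i * w i} := by
    refine convexHull_min (fun u hu => ?_) ?_
    · by_cases huw : u = w
      · exact Or.inl huw
      · exact Or.inr (h u hu huw)
    · rw [convex_iff_forall_pos]
      rintro x hx y hy a b ha hb hab
      have hb' : b = 1 - a := by linarith
      simp only [Set.mem_ofPred_eq]
      rw [aux_dot]
      rcases hx with rfl | hx <;> rcases hy with rfl | hy
      · left
        rw [← add_smul, hab, one_smul]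
      all_goals
        right
        subst hb'
        nlinarith
  rcases hsub hx with h | h
  · exact h
  · exact absurd hxw h.ne

lemma aux_seg {n : ℕ} (V : Set (Fin n → ℝ)) (v w : Fin n → ℝ) (hw : w ∈ V) (hvw : v ≠ w)
    (t : ℝ) (ht : t ≤ 1 / 2) (hx : v + t • (w - v) ∈ convexHull ℝ (V \ {v, w})) :
    (1 / 2 : ℝ) • (v + w) ∈ convexHull ℝ (V \ {v}) := by
  have h1 : v + t • (w - v) ∈ convexHull ℝ (V \ {v}) :=
    convexHull_mono (show V \ {v, w} ⊆ V \ {v} from fun u hu => ⟨hu.1, fun h => hu.2 (Or.inl h)⟩) hx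
  have h2 : w ∈ convexHull ℝ (V \ {v}) := subset_convexHull ℝ _ ⟨hw, fun h => hvw h.symm⟩
  have hp : 0 < 1 - t := by linarith
  have hle : 1 / (2 * (1 - t)) ≤ 1 := by
    rw [div_le_one (by linarith)]; linarith
  have := (convex_convexHull ℝ (V \ {v})) h1 h2 (a := 1 / (2 * (1 - t)))
    (b := 1 - 1 / (2 * (1 - t))) (by positivity) (by linarith) (by ring)
  convert this using 1
  ext i
  simp only [Pi.add_apply, Pi.smul_apply, Pi.sub_apply, smul_eq_mul]
  field_simp
  ring

/-- Adjacency of vertices of a V-polytope characterized via midpoints. -/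
theorem adjacent_vertices_iff_midpoint {n : ℕ} (V : Set (Fin n → ℝ)) (hV : V.Finite)
    (hvert : ∀ u ∈ V, u ∈ Set.extremePoints ℝ (convexHull ℝ V))
    (v w : Fin n → ℝ) (hv : v ∈ V) (hw : w ∈ V) (hvw : v ≠ w) :
    (∃ c : Fin n → ℝ,
        (∑ i, c i * v i) = (∑ i, c i * w i) ∧
        ∀ u ∈ V \ {v, w}, (∑ i, c i * u i) < (∑ i, c i * v i)) ↔
      ((1 / 2 : ℝ) • (v + w) ∉ convexHull ℝ (V \ {v}) ∧
        (1 / 2 : ℝ) • (v + w) ∉ convexHull ℝ (V \ {w})) := by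
  constructor
  · rintro ⟨c, hc, hlt⟩
    have hm : (∑ i, c i * ((1 / 2 : ℝ) • (v + w)) i) = ∑ i, c i * w i := by
      rw [smul_add, aux_dot, hc]; ring
    refine ⟨fun h => hvw ?_, fun h => hvw ?_⟩
    · have := aux_face _ c w (fun u hu huw => hc ▸ hlt u ⟨hu.1, by
        rintro (h | h)
        · exact hu.2 h
        · exact huw h⟩) _ h hm
      ext i
      have := congrFun this i
      simp only [Pi.add_apply, Pi.smul_apply, smul_eq_mul] at this
      linarith
    · have := aux_face _ c v (fun u hu huw => hlt u ⟨hu.1, by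
        rintro (h | h)
        · exact huw h
        · exact hu.2 h⟩) _ h (hm.trans hc.symm)
      ext i
      have := congrFun this i
      simp only [Pi.add_apply, Pi.smul_apply, smul_eq_mul] at this
      linarith
  · rintro ⟨h1, h2⟩
    have hfin : (V \ {v, w}).Finite := hV.subset Set.sdiff_subset
    let L : AffineSubspace ℝ (Fin n → ℝ) := line[ℝ, v, w]
    have hdisj : Disjoint (convexHull ℝ (V \ {v, w})) (L : Set (Fin n → ℝ)) := by
      rw [Set.disjoint_left]
      intro x hx hxL
      obtain ⟨t, rfl⟩ := mem_affineSpan_pair_iff_exists_lineMap_eq.1 hxL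
      have hx' : v + t • (w - v) ∈ convexHull ℝ (V \ {v, w}) := by
        convert hx using 1
        rw [AffineMap.lineMap_apply_module']
        exact add_comm _ _
      rcases le_total t (1 / 2) with ht | ht
      · exact h1 (aux_seg V v w hw hvw t ht hx')
      · apply h2
        rw [add_comm]
        refine aux_seg V w v hv hvw.symm (1 - t) (by linarith) ?_
        rw [Set.pair_comm]
        convert hx' using 1
        module
    obtain ⟨f, a, b, hfa, hab, hfb⟩ := geometric_hahn_banach_compact_closed
      (convex_convexHull ℝ _) (hfin.isCompact_convexHull ℝ) L.convex
      (AffineSubspace.closed_of_finiteDimensional L) hdisj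
    have hline : ∀ t : ℝ, b < f v + t * (f w - f v) := by
      intro t
      have := hfb _ (AffineMap.lineMap_mem_affineSpan_pair t v w)
      rw [AffineMap.lineMap_apply_module'] at this
      simp only [map_add, map_smul, map_sub, smul_eq_mul] at this
      linarith
    have heq : f v = f w := by
      by_contra hne
      have hne' : f w - f v ≠ 0 := fun h => hne (by linarith)
      have := hline ((b - f v) / (f w - f v))
      rw [div_mul_cancel₀ _ hne'] at this
      linarith
    have hf : ∀ x : Fin n → ℝ, (∑ i, f (Pi.single i 1) * x i) = f x := by
      intro x
      conv_rhs => rw [← Finset.univ_sum_single x]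
      rw [map_sum]
      refine Finset.sum_congr rfl fun i _ => ?_
      have : Pi.single i (x i) = x i • (Pi.single i 1 : Fin n → ℝ) := by
        rw [← Pi.single_smul]; simp
      rw [this, map_smul, smul_eq_mul, mul_comm]
    refine ⟨fun i => f (Pi.single i 1), ?_, ?_⟩
    · rw [hf, hf, heq]
    · intro u hu
      rw [hf, hf]
      have h3 := hfa u (subset_convexHull ℝ _ hu)
      have h4 := hline 0
      linarith
end

section
/- If V ⊆ ℝ^n is a set of points all contained in a single closed orthant O_s (for some sign pattern s : Fin n → Bool), then the image under the componentwise ReLU map of the convex hull of V equals the convex hull of the image: ReLU '' (convexHull ℝ V) = convexHull ℝ (ReLU '' V). -/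
/-- ReLU commutes with convex hull for sets contained in a single closed orthant. -/
theorem relu_image_convexHull_of_subset_orthant {n : ℕ} (s : Fin n → Bool)
    (V : Set (Fin n → ℝ))
    (hVs : V ⊆ {z : Fin n → ℝ | ∀ i, if s i = true then 0 ≤ z i else z i ≤ 0}) :
    (fun x : Fin n → ℝ => fun i => max 0 (x i)) '' (convexHull ℝ V) =
      convexHull ℝ ((fun x : Fin n → ℝ => fun i => max 0 (x i)) '' V) := by
  have hconv : Convex ℝ {z : Fin n → ℝ | ∀ i, if s i = true then 0 ≤ z i else z i ≤ 0} := by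
    intro x hx y hy a b ha hb _ i
    have h1 := hx i
    have h2 := hy i
    simp only [Pi.add_apply, Pi.smul_apply, smul_eq_mul]
    split_ifs at h1 h2 ⊢ with h
    · positivity
    · nlinarith [mul_nonneg ha (neg_nonneg.2 h1), mul_nonneg hb (neg_nonneg.2 h2)]
  have hhull := convexHull_min hVs hconv
  let L : (Fin n → ℝ) →ₗ[ℝ] (Fin n → ℝ) :=
    LinearMap.pi fun i => (if s i = true then (1 : ℝ) else 0) • LinearMap.proj i
  have hL : ∀ z ∈ {z : Fin n → ℝ | ∀ i, if s i = true then 0 ≤ z i else z i ≤ 0},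
      (fun x : Fin n → ℝ => fun i => max 0 (x i)) z = L z := by
    intro z hz
    funext i
    have h1 := hz i
    by_cases h : s i = true
    · simp only [h, if_true] at h1
      simp [L, h, h1]
    · simp only [h] at h1
      simpa [L, h] using h1
  rw [Set.image_congr (fun z hz => hL z (hhull hz)),
    Set.image_congr (fun z hz => hL z (hVs hz))]
  exact L.image_convexHull V
end

section
/- Let V be a finite set of points in ℝ^n each of which is an extreme point of the polytope P = convexHull ℝ V, let a : Fin n → ℝ, b : ℝ, and H = {x | ⟨a,x⟩ ≤ b}. If u is an extreme point of P ∩ H that is not an extreme point of P, then ⟨a,u⟩ = b and u lies on an edge of P: there exist distinct x, y ∈ V such that u ∈ segment ℝ x y and the segment [x,y] is an extreme subset of P (IsExtreme ℝ P (segment ℝ x y)). -/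
/-- Directions along which one can move both ways from `u` inside `P`. -/
def TwoWay {E : Type*} [AddCommGroup E] [Module ℝ E] (P : Set E) (u d : E) : Prop :=
  ∃ ε : ℝ, 0 < ε ∧ ∀ s : ℝ, |s| ≤ ε → u + s • d ∈ P

section aux
variable {E : Type*} [AddCommGroup E] [Module ℝ E] {P : Set E} {u : E}

theorem TwoWay.smul {d : E} (h : TwoWay P u d) (c : ℝ) : TwoWay P u (c • d) := by
  obtain ⟨ε, hε, h⟩ := h
  have hc : 0 < |c| + 1 := by positivity
  refine ⟨ε / (|c| + 1), by positivity, fun s hs => ?_⟩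
  rw [smul_smul]
  apply h
  rw [abs_mul]
  rw [le_div_iff₀ hc] at hs
  nlinarith [abs_nonneg s, abs_nonneg c]

theorem TwoWay.add (hP : Convex ℝ P) {d e : E} (h : TwoWay P u d) (h' : TwoWay P u e) :
    TwoWay P u (d + e) := by
  obtain ⟨ε, hε, h⟩ := h
  obtain ⟨δ, hδ, h'⟩ := h'
  refine ⟨min ε δ / 2, by positivity, fun s hs => ?_⟩
  have h2 : |2 * s| ≤ min ε δ := by rw [abs_mul, abs_two]; linarith
  have := hP (h (2 * s) (h2.trans (min_le_left _ _))) (h' (2 * s) (h2.trans (min_le_right _ _)))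
    (by norm_num : (0 : ℝ) ≤ 1 / 2) (by norm_num : (0 : ℝ) ≤ 1 / 2) (by norm_num)
  convert this using 1
  module

theorem TwoWay.of_pair (hP : Convex ℝ P) {d : E} {s t : ℝ} (hs : 0 < s) (ht : 0 < t)
    (h1 : u + s • d ∈ P) (h2 : u - t • d ∈ P) : TwoWay P u d := by
  refine ⟨min s t, lt_min hs ht, fun r hr => ?_⟩
  have hr1 := (abs_le.1 (hr.trans (min_le_left _ _))).2
  have hr2 := (abs_le.1 (hr.trans (min_le_right _ _))).1
  have hst : s + t ≠ 0 := by positivity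
  have := hP h1 h2 (a := (r + t) / (s + t)) (b := (s - r) / (s + t))
    (div_nonneg (by linarith) (by positivity)) (div_nonneg (by linarith) (by positivity))
    (by field_simp; ring)
  convert this using 1
  match_scalars <;> field_simp <;> ring

theorem isExtreme_twoWay (hP : Convex ℝ P) : IsExtreme ℝ P {z ∈ P | TwoWay P u (z - u)} := by
  refine ⟨fun z hz => hz.1, ?_⟩
  rintro z₁ hz₁ z₂ hz₂ z ⟨hz, t, ht, h⟩ ⟨α, β, hα, hβ, hαβ, rfl⟩
  refine ⟨hz₁, ?_⟩
  have hp := h (-t) (by rw [abs_neg, abs_of_pos ht])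
  have hq : 0 < 1 + t * β := by positivity
  refine TwoWay.of_pair hP (s := 1) (t := t * α / (1 + t * β)) one_pos (by positivity)
    (by simpa using hz₁) ?_
  have := hP hp hz₂ (a := 1 / (1 + t * β)) (b := t * β / (1 + t * β))
    (by positivity) (by positivity) (by field_simp)
  convert this using 1
  obtain rfl : α = 1 - β := by linarith
  match_scalars <;> field_simp <;> ring

theorem mem_hull_inter {V F : Set E} (hF : IsExtreme ℝ (convexHull ℝ V) F) {z : E}
    (hz : z ∈ F) : z ∈ convexHull ℝ (V ∩ F) := by
  have hzP := hF.1 hz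
  have hc : convexHull ℝ (V \ F) ⊆ convexHull ℝ V \ F :=
    convexHull_min (fun v hv => ⟨subset_convexHull ℝ V hv.1, hv.2⟩)
      (hF.convex_sdiff (convex_convexHull ℝ V))
  rcases (V ∩ F).eq_empty_or_nonempty with h1 | h1
  · have : V \ F = V := by
      ext v; constructor
      · exact fun h => h.1
      · exact fun h => ⟨h, fun h' => (h1 ▸ (⟨h, h'⟩ : v ∈ V ∩ F) : v ∈ (∅ : Set E))⟩
    rw [this] at hc
    exact absurd hz (hc hzP).2
  rcases (V \ F).eq_empty_or_nonempty with h2 | h2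
  · have : V ∩ F = V := Set.inter_eq_left.2 (Set.diff_eq_empty.1 h2)
    rwa [this]
  rw [← Set.inter_union_diff V F, convexHull_union h1 h2, mem_convexJoin] at hzP
  obtain ⟨p, hp, q, hq, hpq⟩ := hzP
  have hq' := hc hq
  have hp' : p ∈ convexHull ℝ V := convexHull_mono Set.inter_subset_left hp
  by_cases e1 : p = z
  · rwa [← e1]
  by_cases e2 : q = z
  · exact absurd (e2 ▸ hz) hq'.2
  exact absurd (hF.right_mem_of_mem_openSegment hp' hq'.1 hz
    (mem_openSegment_of_ne_left_right e1 e2 hpq)) hq'.2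

theorem edge_aux (V : Set E) (hV : V.Finite)
    (hvert : ∀ v ∈ V, v ∈ Set.extremePoints ℝ (convexHull ℝ V))
    (f : E →ₗ[ℝ] ℝ) (b : ℝ)
    (hu : u ∈ Set.extremePoints ℝ (convexHull ℝ V ∩ {x : E | f x ≤ b}))
    (hu' : u ∉ Set.extremePoints ℝ (convexHull ℝ V)) :
    f u = b ∧ ∃ x ∈ V, ∃ y ∈ V, x ≠ y ∧ u ∈ segment ℝ x y ∧
        IsExtreme ℝ (convexHull ℝ V) (segment ℝ x y) := by
  set P := convexHull ℝ V with hPdef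
  have hP : Convex ℝ P := convex_convexHull ℝ V
  rw [mem_extremePoints_iff_left] at hu
  obtain ⟨⟨huP, huH⟩, hu⟩ := hu
  have huH : f u ≤ b := huH
  have key : ∀ (d : E) (s : ℝ), 0 < s → u + s • d ∈ P → u - s • d ∈ P →
      f u + s * f d ≤ b → f u - s * f d ≤ b → d = 0 := by
    intro d s hs h1 h2 h3 h4
    have := hu (u + s • d) ⟨h1, by simpa using h3⟩ (u - s • d) ⟨h2, by simpa using h4⟩
      ⟨1 / 2, 1 / 2, by norm_num, by norm_num, by norm_num, by module⟩
    have h5 : s • d = 0 := by simpa using this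
    exact (smul_eq_zero.1 h5).resolve_left hs.ne'
  have key0 : ∀ d, TwoWay P u d → f d = 0 → d = 0 := by
    rintro d ⟨ε, hε, h⟩ hd
    refine key d ε hε (h ε (abs_of_pos hε).le) ?_ (by simpa [hd]) (by simpa [hd])
    have := h (-ε) (by rw [abs_neg, abs_of_pos hε])
    rwa [neg_smul, ← sub_eq_add_neg] at this
  set F : Set E := {z ∈ P | TwoWay P u (z - u)} with hFdef
  have hF : IsExtreme ℝ P F := isExtreme_twoWay hP
  have huF : u ∈ F := ⟨huP, 1, one_pos, fun s _ => by simpa using huP⟩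
  have hFc : Convex ℝ F := by
    rintro z ⟨hz, hz'⟩ w ⟨hw, hw'⟩ α β hα hβ hαβ
    refine ⟨hP hz hw hα hβ hαβ, ?_⟩
    have := (hz'.smul α).add hP (hw'.smul β)
    convert this using 1
    obtain rfl : α = 1 - β := by linarith
    module
  have hinj : ∀ z ∈ F, ∀ w ∈ F, f z = f w → z = w := by
    intro z hz w hw h
    have h1 := hz.2.add hP (hw.2.smul (-1))
    have h2 := key0 _ h1 (by simp [h])
    have h3 : z - w = 0 := by rw [← h2]; module
    exact sub_eq_zero.1 h3
  constructor
  · by_contra hne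
    have hlt : f u < b := lt_of_le_of_ne huH hne
    apply hu'
    rw [mem_extremePoints_iff_left]
    refine ⟨huP, fun z₁ hz₁ z₂ hz₂ hz => ?_⟩
    obtain ⟨-, ε, hε, h⟩ := hF.2 hz₁ hz₂ huF hz
    have hc : 0 < |f (z₁ - u)| + 1 := by positivity
    have hbu : 0 < b - f u := by linarith
    obtain ⟨s, hs, hs1, hs2⟩ : ∃ s : ℝ, 0 < s ∧ s ≤ ε ∧ s ≤ (b - f u) / (|f (z₁ - u)| + 1) :=
      ⟨min ε ((b - f u) / (|f (z₁ - u)| + 1)), lt_min hε (by positivity),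
        min_le_left _ _, min_le_right _ _⟩
    rw [le_div_iff₀ hc] at hs2
    have h1 := h s (by rwa [abs_of_pos hs])
    have h2 := h (-s) (by rwa [abs_neg, abs_of_pos hs])
    rw [neg_smul, ← sub_eq_add_neg] at h2
    refine sub_eq_zero.1 (key _ s hs h1 h2 ?_ ?_)
    · nlinarith [le_abs_self (f (z₁ - u))]
    · nlinarith [neg_abs_le (f (z₁ - u))]
  · have hfin : (V ∩ F).Finite := hV.inter_of_left F
    have hne : (V ∩ F).Nonempty := convexHull_nonempty_iff.1 ⟨u, mem_hull_inter hF huF⟩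
    obtain ⟨x, hx, hxm⟩ := Set.exists_min_image (V ∩ F) f hfin hne
    obtain ⟨y, hy, hym⟩ := Set.exists_max_image (V ∩ F) f hfin hne
    have hFs : F = segment ℝ x y := by
      apply Set.Subset.antisymm
      · intro z hz
        have hcv : Convex ℝ (f ⁻¹' Set.Icc (f x) (f y)) := (convex_Icc _ _).linear_preimage f
        have hz2 : z ∈ f ⁻¹' Set.Icc (f x) (f y) :=
          convexHull_min (show V ∩ F ⊆ f ⁻¹' Set.Icc (f x) (f y) from
            fun v hv => ⟨hxm v hv, hym v hv⟩) hcv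
            (mem_hull_inter hF hz)
        have hz3 : f z ∈ segment ℝ (f x) (f y) := by
          rw [segment_eq_Icc (hxm y hy)]; exact hz2
        obtain ⟨α, β, hα, hβ, hαβ, h⟩ := hz3
        have hw : α • x + β • y ∈ F := hFc hx.2 hy.2 hα hβ hαβ
        rw [hinj z hz _ hw (by simp [← h])]
        exact ⟨α, β, hα, hβ, hαβ, rfl⟩
      · exact hFc.segment_subset hx.2 hy.2
    refine ⟨x, hx.1, y, hy.1, ?_, hFs ▸ huF, hFs ▸ hF⟩
    rintro rfl
    rw [hFs, segment_same] at huF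
    rw [Set.mem_singleton_iff.1 huF] at hu'
    exact hu' (hvert x hx.1)

end aux


/-- A new extreme point of the intersection of a V-polytope with a half-space lies on the
supporting hyperplane and on an edge of the polytope. -/
theorem new_extreme_point_on_edge {n : ℕ} (V : Set (Fin n → ℝ)) (hV : V.Finite)
    (hvert : ∀ v ∈ V, v ∈ Set.extremePoints ℝ (convexHull ℝ V))
    (a : Fin n → ℝ) (b : ℝ) (u : Fin n → ℝ)
    (hu : u ∈ Set.extremePoints ℝ
      (convexHull ℝ V ∩ {x : Fin n → ℝ | (∑ i, a i * x i) ≤ b}))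
    (hu' : u ∉ Set.extremePoints ℝ (convexHull ℝ V)) :
    (∑ i, a i * u i) = b ∧
      ∃ x ∈ V, ∃ y ∈ V, x ≠ y ∧ u ∈ segment ℝ x y ∧
        IsExtreme ℝ (convexHull ℝ V) (segment ℝ x y) := by
  let f : (Fin n → ℝ) →ₗ[ℝ] ℝ := ∑ i, a i • LinearMap.proj i
  have hf : ∀ x, f x = ∑ i, a i * x i := fun x => by simp [f]
  have := edge_aux (u := u) V hV hvert f b (by simpa only [hf] using hu) hu'
  rwa [hf] at this
end

section
/- Let C ⊆ ℝ^n be a convex set. Then the image of C under the componentwise ReLU map decomposes as a union over the 2^n closed orthants: ReLU '' C = ⋃ (s : Fin n → Bool), ReLU '' (C ∩ O_s), and for every sign pattern s the set ReLU '' (C ∩ O_s) is convex. -/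
/-- The ReLU image of a convex set decomposes as the union of the (convex) ReLU images of
its orthant pieces. -/
theorem relu_image_eq_union_orthant_pieces {n : ℕ} (C : Set (Fin n → ℝ))
    (hC : Convex ℝ C) :
    ((fun x : Fin n → ℝ => fun i => max 0 (x i)) '' C =
      ⋃ s : Fin n → Bool, (fun x : Fin n → ℝ => fun i => max 0 (x i)) ''
        (C ∩ {x : Fin n → ℝ | ∀ i, if s i = true then 0 ≤ x i else x i ≤ 0})) ∧
    ∀ s : Fin n → Bool, Convex ℝ ((fun x : Fin n → ℝ => fun i => max 0 (x i)) ''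
      (C ∩ {x : Fin n → ℝ | ∀ i, if s i = true then 0 ≤ x i else x i ≤ 0})) := by
  constructor
  · rw [← Set.image_iUnion, ← Set.inter_iUnion]
    congr 1
    symm
    rw [Set.inter_eq_left]
    intro x _
    rw [Set.mem_iUnion]
    refine ⟨fun i => decide (0 ≤ x i), fun i => ?_⟩
    by_cases h : 0 ≤ x i
    · simp [h]
    · simp [h, le_of_lt (not_le.mp h)]
  · rintro s _ ⟨x, ⟨hxC, hx⟩, rfl⟩ _ ⟨y, ⟨hyC, hy⟩, rfl⟩ a b ha hb hab
    have key : ∀ i, (if s i = true then 0 ≤ a * x i + b * y i else a * x i + b * y i ≤ 0) ∧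
        max 0 (a * x i + b * y i) = a * max 0 (x i) + b * max 0 (y i) := by
      intro i
      have h1 := hx i
      have h2 := hy i
      by_cases h : s i = true
      · simp only [h, if_true] at h1 h2 ⊢
        have h3 : 0 ≤ a * x i + b * y i := by positivity
        exact ⟨h3, by rw [max_eq_right h1, max_eq_right h2, max_eq_right h3]⟩
      · simp only [h] at h1 h2 ⊢
        have h3 : a * x i + b * y i ≤ 0 :=
          add_nonpos (mul_nonpos_of_nonneg_of_nonpos ha h1)
            (mul_nonpos_of_nonneg_of_nonpos hb h2)
        exact ⟨h3, by rw [max_eq_left h1, max_eq_left h2, max_eq_left h3]; simp⟩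
    refine ⟨a • x + b • y, ⟨hC hxC hyC ha hb hab, fun i => ?_⟩, ?_⟩
    · simpa using (key i).1
    · funext i
      simpa using (key i).2
end

section
/- Let K ⊆ ℝ^n be a compact convex set. Then the exact image of K under the componentwise ReLU map equals the union, over all sign patterns s : Fin n → Bool, of the convex hulls of the ReLU-images of the extreme points of the orthant pieces: ReLU '' K = ⋃ (s : Fin n → Bool), convexHull ℝ (ReLU '' (Set.extremePoints ℝ (K ∩ O_s))). -/
/-- Minkowski's theorem in finite dimension, by induction on the dimension. -/
theorem minkowski_aux (d : ℕ) : ∀ (E : Type) [NormedAddCommGroup E] [NormedSpace ℝ E]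
    [FiniteDimensional ℝ E], Module.finrank ℝ E = d → ∀ S : Set E, IsCompact S → Convex ℝ S →
    S ⊆ convexHull ℝ (S.extremePoints ℝ) := by
  induction d using Nat.strong_induction_on with
  | _ d ih =>
  intro E _ _ _ hd S hS hSc x hx
  -- transport to a proper subspace
  have transport : ∀ (W : Submodule ℝ E), W ≠ ⊤ → ∀ F : Set E, IsCompact F → Convex ℝ F →
      x ∈ F → (∀ y ∈ F, y - x ∈ W) → x ∈ convexHull ℝ (F.extremePoints ℝ) := by
    intro W hW F hF hFc hxF hFW
    have hlt : Module.finrank ℝ W < d := hd ▸ Submodule.finrank_lt hW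
    let φ : W →ᵃ[ℝ] E := W.subtype.toAffineMap + AffineMap.const ℝ W x
    have hφ : ∀ w : W, φ w = (w : E) + x := fun w => rfl
    have hinj : Function.Injective φ := by
      intro a b hab
      rw [hφ, hφ] at hab
      exact Subtype.ext (add_right_cancel hab)
    have hTcl : Topology.IsClosedEmbedding φ := by
      have h1 : Topology.IsClosedEmbedding (fun w : W => (w : E)) :=
        (Submodule.closed_of_finiteDimensional W).isClosedEmbedding_subtypeVal
      exact (Homeomorph.addRight x).isClosedEmbedding.comp h1
    have hT : IsCompact (φ ⁻¹' F) := hTcl.isCompact_preimage hF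
    have hTc : Convex ℝ (φ ⁻¹' F) := hFc.affine_preimage φ
    have h0 : (0 : W) ∈ φ ⁻¹' F := by
      change φ 0 ∈ F
      rw [hφ]; simpa using hxF
    have key := ih _ hlt W rfl _ hT hTc h0
    have h2 : φ 0 ∈ φ '' convexHull ℝ ((φ ⁻¹' F).extremePoints ℝ) := ⟨0, key, rfl⟩
    rw [AffineMap.image_convexHull] at h2
    have h3 : φ 0 = x := by rw [hφ]; simp
    rw [h3] at h2
    refine convexHull_mono ?_ h2
    rintro _ ⟨w, hw, rfl⟩
    refine ⟨hw.1, ?_⟩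
    intro a ha b hb hab
    have hlift : ∀ y ∈ F, ∃ v : W, φ v = y := fun y hy =>
      ⟨⟨y - x, hFW y hy⟩, by rw [hφ]; simp⟩
    obtain ⟨a', rfl⟩ := hlift a ha
    obtain ⟨b', rfl⟩ := hlift b hb
    rw [← image_openSegment] at hab
    obtain ⟨c, hc, hcw⟩ := hab
    rw [hinj hcw] at hc
    rw [hw.2 ha hb hc]
  by_cases hspan : affineSpan ℝ S = ⊤
  · have hint : (interior S).Nonempty := hSc.interior_nonempty_iff_affineSpan_eq_top.2 hspan
    by_cases hxi : x ∈ interior S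
    · set C := convexHull ℝ (S.extremePoints ℝ) with hC
      have hCc : Convex ℝ C := convex_convexHull ℝ _
      have hcl : closure C = S := closure_convexHull_extremePoints hS hSc
      have hCi : (interior C).Nonempty := by
        rw [hCc.interior_nonempty_iff_affineSpan_eq_top]
        rw [eq_top_iff, ← hspan, affineSpan_le]
        rw [← hcl]
        exact closure_minimal (subset_affineSpan ℝ C) (AffineSubspace.closed_of_finiteDimensional _)
      rw [← hcl, hCc.interior_closure_eq_interior_of_nonempty_interior hCi] at hxi
      exact interior_subset hxi
    · obtain ⟨f, hf⟩ := geometric_hahn_banach_open_point hSc.interior isOpen_interior hxi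
      have hle : ∀ y ∈ S, f y ≤ f x := by
        intro y hy
        have : S ⊆ {y | f y ≤ f x} := by
          have h1 : S ⊆ closure (interior S) := by
            rw [hSc.closure_interior_eq_closure_of_nonempty_interior hint]
            exact subset_closure
          exact h1.trans (closure_minimal (fun a ha => (hf a ha).le)
            (isClosed_le f.continuous continuous_const))
        exact this hy
      have hW : LinearMap.ker (f : E →ₗ[ℝ] ℝ) ≠ ⊤ := by
        intro h
        obtain ⟨a, ha⟩ := hint
        have h1 := hf a ha
        have h2 : ∀ y, f y = 0 := fun y => by
          have : y ∈ LinearMap.ker (f : E →ₗ[ℝ] ℝ) := h ▸ Submodule.mem_top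
          simpa using this
        rw [h2, h2] at h1
        exact lt_irrefl _ h1
      have hcl : IsClosed {y | f y = f x} := isClosed_eq f.continuous continuous_const
      have hcv : Convex ℝ {y | f y = f x} := by
        exact convex_hyperplane (f : E →ₗ[ℝ] ℝ).isLinear (f x)
      have key := transport _ hW (S ∩ {y | f y = f x}) (hS.inter_right hcl) (hSc.inter hcv)
        ⟨hx, rfl⟩ (fun y hy => by
          have : f y = f x := hy.2
          simp [this])
      refine convexHull_mono ?_ key
      rintro p ⟨⟨hpS, hpf⟩, hp⟩
      refine ⟨hpS, ?_⟩
      intro a ha b hb hab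
      have hab' := hab
      obtain ⟨s, t, hs, ht, hst, rfl⟩ := hab'
      have e : s * f a + t * f b = f x := by simpa using hpf
      have ha' := hle a ha
      have hb' := hle b hb
      have hfa : f a = f x := by
        obtain rfl : t = 1 - s := by linarith
        nlinarith [mul_nonneg ht.le (sub_nonneg.2 hb'), mul_nonneg hs.le (sub_nonneg.2 ha')]
      have hfb : f b = f x := by
        obtain rfl : t = 1 - s := by linarith
        rw [hfa] at e
        nlinarith
      exact hp ⟨ha, hfa⟩ ⟨hb, hfb⟩ hab
  · refine transport (vectorSpan ℝ S) ?_ S hS hSc hx (fun y hy => vsub_mem_vectorSpan ℝ hy hx)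
    intro h
    exact hspan ((AffineSubspace.affineSpan_eq_top_iff_vectorSpan_eq_top_of_nonempty ℝ E E
      ⟨x, hx⟩).2 h)

/-- The exact ReLU image of a compact convex set equals the union over orthants of the
convex hulls of the ReLU images of the extreme points of the orthant pieces. -/
theorem relu_image_eq_union_convexHull_extremePoints {n : ℕ} (K : Set (Fin n → ℝ))
    (hK : IsCompact K) (hKc : Convex ℝ K) :
    (fun x : Fin n → ℝ => fun i => max 0 (x i)) '' K =
      ⋃ s : Fin n → Bool, convexHull ℝ
        ((fun x : Fin n → ℝ => fun i => max 0 (x i)) ''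
          Set.extremePoints ℝ
            (K ∩ {x : Fin n → ℝ | ∀ i, if s i = true then 0 ≤ x i else x i ≤ 0})) := by
  have piece : ∀ s : Fin n → Bool, convexHull ℝ
        ((fun x : Fin n → ℝ => fun i => max 0 (x i)) ''
          Set.extremePoints ℝ
            (K ∩ {x : Fin n → ℝ | ∀ i, if s i = true then 0 ≤ x i else x i ≤ 0})) =
      (fun x : Fin n → ℝ => fun i => max 0 (x i)) ''
        (K ∩ {x : Fin n → ℝ | ∀ i, if s i = true then 0 ≤ x i else x i ≤ 0}) := by
    intro s
    set O : Set (Fin n → ℝ) := {x | ∀ i, if s i = true then 0 ≤ x i else x i ≤ 0} with hO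
    let L : (Fin n → ℝ) →ₗ[ℝ] (Fin n → ℝ) :=
      LinearMap.pi fun i => (if s i = true then (1 : ℝ) else 0) • LinearMap.proj i
    have hL : ∀ x ∈ O, (fun i => max 0 (x i)) = L x := by
      intro x hx
      funext i
      have := hx i
      by_cases h : s i = true
      · simp_all [L]
      · simp_all [L]
    have hOeq : O = ⋂ i, {x : Fin n → ℝ | if s i = true then 0 ≤ x i else x i ≤ 0} := by
      ext x; simp [hO]
    have hOcl : IsClosed O := by
      rw [hOeq]
      refine isClosed_iInter fun i => ?_
      by_cases h : s i = true
      · simp only [h, if_true]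
        exact isClosed_le continuous_const (continuous_apply i)
      · simp only [h]
        exact isClosed_le (continuous_apply i) continuous_const
    have hOcv : Convex ℝ O := by
      rw [hOeq]
      refine convex_iInter fun i => ?_
      by_cases h : s i = true
      · simp only [h, if_true]
        exact convex_halfSpace_ge (LinearMap.proj (R := ℝ) (φ := fun _ : Fin n => ℝ) i).isLinear 0
      · simp only [h]
        exact convex_halfSpace_le (LinearMap.proj (R := ℝ) (φ := fun _ : Fin n => ℝ) i).isLinear 0
    have hmk : convexHull ℝ ((K ∩ O).extremePoints ℝ) = K ∩ O :=
      (convexHull_min extremePoints_subset (hKc.inter hOcv)).antisymm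
        (minkowski_aux _ _ rfl _ (hK.inter_right hOcl) (hKc.inter hOcv))
    rw [Set.image_congr (fun x hx => hL x (extremePoints_subset hx).2),
      Set.image_congr (fun x (hx : x ∈ K ∩ O) => hL x hx.2)]
    have := L.image_convexHull ((K ∩ O).extremePoints ℝ)
    rw [hmk] at this
    exact this.symm
  simp_rw [piece]
  rw [← Set.image_iUnion, ← Set.inter_iUnion]
  congr 1
  refine (Set.inter_eq_left.2 fun x _ => ?_).symm
  refine Set.mem_iUnion.2 ⟨fun i => decide (0 ≤ x i), fun i => ?_⟩
  by_cases h : 0 ≤ x i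
  · simp [h]
  · simp [h, (not_le.1 h).le]
end

section
/- Let W be an m × n real matrix, θ : Fin m → ℝ, and let the layer map F : ℝ^n → ℝ^m be F x = ReLU (W.mulVec x + θ), where ReLU acts componentwise. Let V ⊆ ℝ^n be a finite set and P = convexHull ℝ V. Then the exact layer output F '' P is contained in the convex hull of the union, over sign patterns s : Fin m → Bool, of the ReLU-images of the extreme points of the orthant pieces of the affine image: F '' P ⊆ convexHull ℝ (⋃ (s : Fin m → Bool), ReLU '' (Set.extremePoints ℝ (convexHull ℝ ((fun x => W.mulVec x + θ) '' V) ∩ O_s))). -/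
open Filter Topology in
lemma exists_eps_aux (a b : ℝ) (ha : 0 ≤ a) (h : a = 0 → b = 0) :
    ∀ᶠ e : ℝ in 𝓝[>] 0, 0 ≤ (1 + e) * a - e * b := by
  rcases ha.eq_or_lt with h0 | h0
  · have := h h0.symm
    simp [← h0, this]
  · apply Filter.Eventually.filter_mono nhdsWithin_le_nhds
    have hc : ContinuousAt (fun e : ℝ => (1 + e) * a - e * b) 0 := by fun_prop
    have := hc.eventually (lt_mem_nhds (a := 0) (by simpa using h0))
    exact this.mono fun _ h => h.le

open Filter Topology in
lemma piece_extreme_finite {m : ℕ} (S : Finset (Fin m → ℝ)) (s : Fin m → Bool) :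
    (Set.extremePoints ℝ (convexHull ℝ (S : Set (Fin m → ℝ)) ∩
      {y : Fin m → ℝ | ∀ i, if s i = true then 0 ≤ y i else y i ≤ 0})).Finite := by
  classical
  have H : ∀ y : Fin m → ℝ, ∃ w : (Fin m → ℝ) → ℝ, y ∈ convexHull ℝ (S : Set (Fin m → ℝ)) →
      (∀ v ∈ S, 0 ≤ w v) ∧ ∑ v ∈ S, w v = 1 ∧ ∑ v ∈ S, w v • v = y := by
    intro y
    by_cases hy : y ∈ convexHull ℝ (S : Set (Fin m → ℝ))
    · obtain ⟨w, hw⟩ := Finset.mem_convexHull'.1 hy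
      exact ⟨w, fun _ => hw⟩
    · exact ⟨0, fun h => absurd h hy⟩
  choose w hw using H
  let f : (Fin m → ℝ) → Finset (Fin m → ℝ) × Finset (Fin m) := fun y =>
    (S.filter (fun v => w y v = 0), Finset.univ.filter (fun i => y i = 0))
  apply Set.Finite.of_finite_image (f := f)
  · apply Set.Finite.subset (S.powerset ×ˢ (Finset.univ : Finset (Finset (Fin m)))).finite_toSet
    rintro _ ⟨y, -, rfl⟩
    simp only [f, Finset.coe_product, Set.mem_prod, Finset.mem_coe, Finset.mem_powerset,
      Finset.mem_univ, and_true]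
    exact Finset.filter_subset _ _
  · intro y hy z hz hyz
    obtain ⟨hyA, hye⟩ := mem_extremePoints_iff_left.1 hy
    have hzA := hz.1
    obtain ⟨hw0, hw1, hwy⟩ := hw y hyA.1
    obtain ⟨hz0, hz1, hwz⟩ := hw z hzA.1
    simp only [f, Prod.mk.injEq] at hyz
    have h1 : ∀ v ∈ S, w y v = 0 → w z v = 0 := fun v hv h => by
      have : v ∈ S.filter (fun v => w z v = 0) := by rw [← hyz.1]; simp [hv, h]
      exact (Finset.mem_filter.1 this).2
    have h2 : ∀ i, y i = 0 → z i = 0 := fun i h => by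
      have : i ∈ Finset.univ.filter (fun i => z i = 0) := by rw [← hyz.2]; simp [h]
      exact (Finset.mem_filter.1 this).2
    have e1 : ∀ᶠ e : ℝ in 𝓝[>] 0, ∀ v ∈ S, 0 ≤ (1 + e) * w y v - e * w z v :=
      (Filter.eventually_all_finset S).2 fun v hv => exists_eps_aux _ _ (hw0 v hv) (h1 v hv)
    have e2 : ∀ᶠ e : ℝ in 𝓝[>] 0, ∀ i, if s i = true then 0 ≤ (1 + e) * y i - e * z i
        else (1 + e) * y i - e * z i ≤ 0 := by
      refine Filter.eventually_all.2 fun i => ?_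
      have hi := hyA.2 i
      split_ifs at hi ⊢ with hs
      · exact exists_eps_aux _ _ hi (h2 i)
      · have := exists_eps_aux (-y i) (-z i) (by linarith) (fun h => by
          rw [h2 i (by linarith)]; simp)
        exact this.mono fun e he => by linarith
    obtain ⟨e, ⟨he1, he2⟩, he⟩ := ((e1.and e2).and self_mem_nhdsWithin).exists
    have he : 0 < e := he
    have hx : (1 + e) • y - e • z ∈ convexHull ℝ (S : Set (Fin m → ℝ)) ∩
        {y : Fin m → ℝ | ∀ i, if s i = true then 0 ≤ y i else y i ≤ 0} := by
      refine ⟨Finset.mem_convexHull'.2 ⟨fun v => (1 + e) * w y v - e * w z v, he1, ?_, ?_⟩, ?_⟩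
      · rw [Finset.sum_sub_distrib, ← Finset.mul_sum, ← Finset.mul_sum, hw1, hz1]; ring
      · simp only [sub_smul, mul_smul, Finset.sum_sub_distrib, ← Finset.smul_sum]
        rw [hwy, hwz]
      · intro i
        simpa using he2 i
    refine (hye z hzA _ hx ⟨e / (1 + e), 1 / (1 + e), by positivity, by positivity, ?_, ?_⟩).symm
    · field_simp; ring
    · ext i
      simp
      field_simp
      ring

/-- Soundness of the layer mapping (APNM): the exact layer output of a V-polytope is
contained in the convex hull of the union, over orthants, of the ReLU images of the extreme
points of the orthant pieces of the affine image. -/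
theorem layer_output_subset_convexHull {n m : ℕ} (W : Matrix (Fin m) (Fin n) ℝ)
    (θ : Fin m → ℝ) (V : Set (Fin n → ℝ)) (hV : V.Finite) :
    (fun x : Fin n → ℝ => fun i => max 0 ((W.mulVec x + θ) i)) '' (convexHull ℝ V) ⊆
      convexHull ℝ (⋃ s : Fin m → Bool,
        (fun y : Fin m → ℝ => fun i => max 0 (y i)) ''
          Set.extremePoints ℝ
            (convexHull ℝ ((fun x : Fin n → ℝ => W.mulVec x + θ) '' V) ∩
              {y : Fin m → ℝ | ∀ i, if s i = true then 0 ≤ y i else y i ≤ 0})) := by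
  classical
  rintro _ ⟨x, hx, rfl⟩
  let g : (Fin n → ℝ) →ᵃ[ℝ] (Fin m → ℝ) :=
    W.mulVecLin.toAffineMap + AffineMap.const ℝ _ θ
  have hg : ∀ x, g x = W.mulVec x + θ := fun x => by simp [g]
  have hy : W.mulVec x + θ ∈ convexHull ℝ ((fun x : Fin n → ℝ => W.mulVec x + θ) '' V) := by
    have h := Set.mem_image_of_mem g hx
    rw [AffineMap.image_convexHull, hg] at h
    have : (g : (Fin n → ℝ) → (Fin m → ℝ)) = fun x => W.mulVec x + θ := funext hg
    rwa [this] at h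
  have hfin := hV.image (fun x : Fin n → ℝ => W.mulVec x + θ)
  beta_reduce
  generalize (fun x : Fin n → ℝ => W.mulVec x + θ) '' V = V' at hy hfin ⊢
  generalize W.mulVec x + θ = y at hy
  let s : Fin m → Bool := fun i => decide (0 ≤ y i)
  let O : Set (Fin m → ℝ) := {y : Fin m → ℝ | ∀ i, if s i = true then 0 ≤ y i else y i ≤ 0}
  have hyO : y ∈ O := by
    intro i
    by_cases h : 0 ≤ y i
    · simp [s, h]
    · simp [s, h]; linarith
  have hOi : O = ⋂ i, {y : Fin m → ℝ | if s i = true then 0 ≤ y i else y i ≤ 0} := by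
    ext; simp [O]
  have hOc : IsClosed O := by
    rw [hOi]
    refine isClosed_iInter fun i => ?_
    cases s i
    · simpa using isClosed_le (continuous_apply i) continuous_const
    · simpa using isClosed_le continuous_const (continuous_apply i)
  have hOv : Convex ℝ O := by
    intro a ha b hb p q hp hq hpq i
    have h1 := ha i
    have h2 := hb i
    simp only [Pi.add_apply, Pi.smul_apply, smul_eq_mul]
    split_ifs at h1 h2 ⊢ with h
    · positivity
    · nlinarith [mul_nonneg hp (neg_nonneg.2 h1), mul_nonneg hq (neg_nonneg.2 h2)]
  have hKM := closure_convexHull_extremePoints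
    ((hfin.isCompact_convexHull ℝ).inter_right hOc) ((convex_convexHull ℝ V').inter hOv)
  have hF : (Set.extremePoints ℝ (convexHull ℝ V' ∩ O)).Finite := by
    have := piece_extreme_finite hfin.toFinset s
    rwa [hfin.coe_toFinset] at this
  rw [(hF.isClosed_convexHull ℝ).closure_eq] at hKM
  have hy2 : y ∈ convexHull ℝ (Set.extremePoints ℝ (convexHull ℝ V' ∩ O)) := by
    rw [hKM]; exact ⟨hy, hyO⟩
  let L : (Fin m → ℝ) →ₗ[ℝ] (Fin m → ℝ) :=
    LinearMap.pi fun i => (if s i = true then (1 : ℝ) else 0) • LinearMap.proj i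
  have hL : ∀ z ∈ O, L z = fun i => max 0 (z i) := by
    intro z hz
    ext i
    have := hz i
    simp only [L, LinearMap.pi_apply, LinearMap.smul_apply, LinearMap.proj_apply, smul_eq_mul]
    split_ifs at this ⊢ with h
    · simp [this]
    · simp [this]
  rw [← hL y hyO]
  have h3 := Set.mem_image_of_mem L hy2
  rw [LinearMap.image_convexHull] at h3
  refine convexHull_mono ?_ h3
  rintro _ ⟨z, hz, rfl⟩
  exact Set.mem_iUnion.2 ⟨s, z, hz, (hL z hz.1.2).symm⟩
end

section
/- Let W be an m × n real matrix, θ : Fin m → ℝ, and let the layer map F : ℝ^n → ℝ^m be F x = ReLU (W.mulVec x + θ), where ReLU acts componentwise. Let V ⊆ ℝ^n be a finite set and P = convexHull ℝ V. Then the exact layer output is the union, over sign patterns s : Fin m → Bool, of the convex hulls of the ReLU-images of the extreme points of the orthant pieces of the affine image: F '' P = ⋃ (s : Fin m → Bool), convexHull ℝ (ReLU '' (Set.extremePoints ℝ (convexHull ℝ ((fun x => W.mulVec x + θ) '' V) ∩ O_s))). -/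
/-- The closed orthant with sign pattern `s`. -/
def orth {m : ℕ} (s : Fin m → Bool) : Set (Fin m → ℝ) :=
  {y : Fin m → ℝ | ∀ i, if s i = true then 0 ≤ y i else y i ≤ 0}

theorem orth_convex {m : ℕ} (s : Fin m → Bool) : Convex ℝ (orth s) := by
  intro x hx y hy a b ha hb _ i
  have h1 := hx i
  have h2 := hy i
  simp only [Pi.add_apply, Pi.smul_apply, smul_eq_mul]
  split_ifs at * with h
  · positivity
  · have := mul_nonneg ha (neg_nonneg.2 h1)
    have := mul_nonneg hb (neg_nonneg.2 h2)
    linarith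

theorem orth_closed {m : ℕ} (s : Fin m → Bool) : IsClosed (orth s) := by
  have : orth s = ⋂ i, {y : Fin m → ℝ | if s i = true then 0 ≤ y i else y i ≤ 0} := by
    ext y; simp [orth]
  rw [this]
  refine isClosed_iInter fun i => ?_
  by_cases h : s i = true
  · simp only [h, if_true]
    exact isClosed_le continuous_const (continuous_apply i)
  · simp only [h]
    exact isClosed_le (continuous_apply i) continuous_const

open Filter Topology in
theorem ev_nonneg {a b : ℝ} (ha : 0 ≤ a) (h : a = 0 → b = 0) :
    ∀ᶠ t in 𝓝[>] (0 : ℝ), 0 ≤ a + t * (a - b) := by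
  rcases ha.eq_or_lt with h0 | h0
  · have hb := h h0.symm
    subst h0
    simp [hb]
  · have hc : Tendsto (fun t : ℝ => a + t * (a - b)) (𝓝 0) (𝓝 (a + 0 * (a - b))) := by
      apply Continuous.tendsto
      fun_prop
    have h1 : ∀ᶠ t in 𝓝 (0 : ℝ), 0 < a + t * (a - b) :=
      hc.eventually (lt_mem_nhds (by simpa using h0))
    exact (h1.filter_mono nhdsWithin_le_nhds).mono fun t ht => ht.le

open Filter Topology in
theorem ext_finite {m : ℕ} (s : Fin m → Bool) (V : Finset (Fin m → ℝ)) :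
    (Set.extremePoints ℝ (convexHull ℝ (V : Set (Fin m → ℝ)) ∩ orth s)).Finite := by
  classical
  set K := convexHull ℝ (V : Set (Fin m → ℝ)) ∩ orth s with hK
  have hw : ∀ x : Fin m → ℝ, ∃ w : (Fin m → ℝ) → ℝ, x ∈ K →
      (∀ y ∈ V, 0 ≤ w y) ∧ ∑ y ∈ V, w y = 1 ∧ ∑ y ∈ V, w y • y = x := by
    intro x
    by_cases hx : x ∈ K
    · obtain ⟨w, h⟩ := Finset.mem_convexHull'.1 hx.1
      exact ⟨w, fun _ => h⟩
    · exact ⟨0, fun h => absurd h hx⟩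
  choose w hw using hw
  let g : (Fin m → ℝ) → Finset (Fin m → ℝ) × Finset (Fin m) := fun x =>
    (V.filter fun v => w x v = 0, Finset.univ.filter fun i => x i = 0)
  refine Set.Finite.of_injOn (f := g)
    (t := ((V.powerset ×ˢ (Finset.univ : Finset (Finset (Fin m))) : Finset _) : Set _))
    ?_ ?_ (Finset.finite_toSet _)
  · intro x _
    simp [g]
    exact fun v hv => hv.1
  · intro x hx y hy hxy
    have hxK := hx.1
    have hyK := hy.1
    obtain ⟨hx0, hx1, hx2⟩ := hw x hxK
    obtain ⟨hy0, hy1, hy2⟩ := hw y hyK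
    have hS : ∀ v ∈ V, w x v = 0 → w y v = 0 := by
      intro v hv h
      have h1 : v ∈ (g x).1 := by simp [g, hv, h]
      rw [hxy] at h1
      exact (Finset.mem_filter.1 h1).2
    have hZ : ∀ i, x i = 0 → y i = 0 := by
      intro i h
      have h1 : i ∈ (g x).2 := by simp [g, h]
      rw [hxy] at h1
      exact (Finset.mem_filter.1 h1).2
    have e1 : ∀ᶠ t in 𝓝[>] (0 : ℝ), ∀ v ∈ V, 0 ≤ w x v + t * (w x v - w y v) :=
      (Finset.eventually_all V).2 fun v hv => ev_nonneg (hx0 v hv) (hS v hv)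
    have e2 : ∀ᶠ t in 𝓝[>] (0 : ℝ), x + t • (x - y) ∈ orth s := by
      refine eventually_all.2 fun i => ?_
      have h1 := hxK.2 i
      by_cases h : s i = true
      · simp only [h, if_true] at h1 ⊢
        exact ev_nonneg h1 (hZ i)
      · simp only [h] at h1 ⊢
        have := ev_nonneg (a := -x i) (b := -y i) (neg_nonneg.2 h1)
          (fun hh => by rw [hZ i (neg_eq_zero.1 hh), neg_zero])
        filter_upwards [this] with t ht
        simp only [Pi.add_apply, Pi.smul_apply, Pi.sub_apply, smul_eq_mul]
        show x i + t * (x i - y i) ≤ 0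
        linarith
    obtain ⟨t, ⟨ht1, ht2⟩, ht⟩ := ((e1.and e2).and self_mem_nhdsWithin).exists
    have ht : 0 < t := ht
    have hz : x + t • (x - y) ∈ K := by
      refine ⟨Finset.mem_convexHull'.2 ⟨fun v => w x v + t * (w x v - w y v), ht1, ?_, ?_⟩, ht2⟩
      · rw [Finset.sum_add_distrib, ← Finset.mul_sum, Finset.sum_sub_distrib, hx1, hy1]
        ring
      · simp only [add_smul, mul_smul, sub_smul]
        rw [Finset.sum_add_distrib, ← Finset.smul_sum, Finset.sum_sub_distrib, hx2, hy2]
    have hseg : x ∈ openSegment ℝ y (x + t • (x - y)) := by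
      refine ⟨t / (1 + t), 1 / (1 + t), by positivity, by positivity, by field_simp; ring, ?_⟩
      ext i
      simp only [Pi.add_apply, Pi.smul_apply, Pi.sub_apply, smul_eq_mul]
      field_simp
      ring
    exact (hx.2 hyK hz hseg).symm

theorem hull_ext {m : ℕ} (s : Fin m → Bool) (V : Set (Fin m → ℝ)) (hV : V.Finite) :
    convexHull ℝ (Set.extremePoints ℝ (convexHull ℝ V ∩ orth s)) = convexHull ℝ V ∩ orth s := by
  have hf := ext_finite s hV.toFinset
  rw [hV.coe_toFinset] at hf
  rw [← (hf.isClosed_convexHull ℝ).closure_eq]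
  exact closure_convexHull_extremePoints
    ((hV.isCompact_convexHull ℝ).inter_right (orth_closed s))
    ((convex_convexHull ℝ V).inter (orth_convex s))

/-- On the orthant `s`, ReLU agrees with this linear map. -/
def reluLin {m : ℕ} (s : Fin m → Bool) : (Fin m → ℝ) →ₗ[ℝ] (Fin m → ℝ) :=
  LinearMap.pi fun i => if s i = true then LinearMap.proj i else 0

theorem reluLin_eq {m : ℕ} (s : Fin m → Bool) {y : Fin m → ℝ} (hy : y ∈ orth s) :
    (fun i => max 0 (y i)) = reluLin s y := by
  ext i
  have h1 := hy i
  by_cases h : s i = true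
  · simp only [h, if_true] at h1
    simp [reluLin, h, h1]
  · simp only [h] at h1
    simpa [reluLin, h] using h1

theorem piece {m : ℕ} (s : Fin m → Bool) (V : Set (Fin m → ℝ)) (hV : V.Finite) :
    convexHull ℝ ((fun y : Fin m → ℝ => fun i => max 0 (y i)) ''
      Set.extremePoints ℝ (convexHull ℝ V ∩ orth s)) =
    (fun y : Fin m → ℝ => fun i => max 0 (y i)) '' (convexHull ℝ V ∩ orth s) := by
  have h1 : (fun y : Fin m → ℝ => fun i => max 0 (y i)) ''
      Set.extremePoints ℝ (convexHull ℝ V ∩ orth s) =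
      reluLin s '' Set.extremePoints ℝ (convexHull ℝ V ∩ orth s) :=
    Set.image_congr fun y hy => reluLin_eq s hy.1.2
  have h2 : (fun y : Fin m → ℝ => fun i => max 0 (y i)) '' (convexHull ℝ V ∩ orth s) =
      reluLin s '' (convexHull ℝ V ∩ orth s) :=
    Set.image_congr fun y hy => reluLin_eq s hy.2
  rw [h1, h2, ← LinearMap.image_convexHull, hull_ext s V hV]

/-- Exactness of the layer mapping (EPNM): the exact layer output of a V-polytope equals the
union, over orthants, of the convex hulls of the ReLU images of the extreme points of the
orthant pieces of the affine image. -/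
theorem layer_output_eq_union_convexHull {n m : ℕ} (W : Matrix (Fin m) (Fin n) ℝ)
    (θ : Fin m → ℝ) (V : Set (Fin n → ℝ)) (hV : V.Finite) :
    (fun x : Fin n → ℝ => fun i => max 0 ((W.mulVec x + θ) i)) '' (convexHull ℝ V) =
      ⋃ s : Fin m → Bool, convexHull ℝ
        ((fun y : Fin m → ℝ => fun i => max 0 (y i)) ''
          Set.extremePoints ℝ
            (convexHull ℝ ((fun x : Fin n → ℝ => W.mulVec x + θ) '' V) ∩
              {y : Fin m → ℝ | ∀ i, if s i = true then 0 ≤ y i else y i ≤ 0})) := by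
  have hA : (fun x : Fin n → ℝ => W.mulVec x + θ) '' convexHull ℝ V =
      convexHull ℝ ((fun x : Fin n → ℝ => W.mulVec x + θ) '' V) := by
    have := AffineMap.image_convexHull
      (W.mulVecLin.toAffineMap + AffineMap.const ℝ (Fin n → ℝ) θ) V
    exact this
  have hF : (fun x : Fin n → ℝ => fun i => max 0 ((W.mulVec x + θ) i)) '' (convexHull ℝ V) =
      (fun y : Fin m → ℝ => fun i => max 0 (y i)) ''
        convexHull ℝ ((fun x : Fin n → ℝ => W.mulVec x + θ) '' V) := by
    rw [← hA, Set.image_image]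
  rw [hF]
  have hp := fun s => piece s _ (hV.image fun x : Fin n → ℝ => W.mulVec x + θ)
  unfold orth at hp
  simp only [hp]
  rw [← Set.image_iUnion, ← Set.inter_iUnion]
  congr 1
  symm
  apply Set.inter_eq_left.2
  intro y _
  refine Set.mem_iUnion.2 ⟨fun i => decide (0 ≤ y i), fun i => ?_⟩
  by_cases h : 0 ≤ y i
  · simp [h]
  · simpa [h] using (not_le.1 h).le
end
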